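/- arXiv:1904.02652 — 2 statements merged into one kernel-verified Lean document; each statement's English description precedes it below -/
import Mathlib

section
/- Let σ : ℤ → ℤ be defined by σ(k) = (k−2)(k−4)/4 if k is even and σ(k) = (k−3)²/4 if k is odd. Let n ≥ 2 be an integer, let F and S be finite index sets, and let e : F ⊕ S → ℤ satisfy e_p ≥ 1 for all p, together with the constraint Σ_{p∈S} e_p = n − 1. Define μ = n(n−1) + Σ_{p∈F} e_p(e_p−1) + Σ_{p∈S} e_p(e_p−1) and τ_min = σ(n) + (n²+3n−6)/2 + Σ_{p∈F} ((e_p−1)(e_p+2) + 2σ(e_p+1))/2 + Σ_{p∈S} (e_p(e_p−1) + 2σ(e_p+2))/2. Then 4·τ_min − 3·μ ≥ 2n − 3 + Σ_{p∈F} (e_p − 1) > 0; in particular 3·μ < 4·τ_min. -/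
/-- Genzmer's function `σ`: `σ(k) = (k-2)(k-4)/4` for even `k` and
`σ(k) = (k-3)²/4` for odd `k`. -/
def sigma (k : ℤ) : ℤ := if Even k then (k - 2) * (k - 4) / 4 else (k - 3) ^ 2 / 4

theorem sub_two_mul_sub_four_le_four_mul_sigma (k : ℤ) :
    (k - 2) * (k - 4) ≤ 4 * sigma k := by
  unfold sigma
  rcases Int.even_or_odd' k with ⟨m, rfl | rfl⟩
  · rw [if_pos (even_two_mul m),
      show (2 * m - 2) * (2 * m - 4) = 4 * ((m - 1) * (m - 2)) by ring]
    omega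
  · rw [if_neg (by simp),
      show (2 * m + 1 - 3) ^ 2 = 4 * (m - 1) ^ 2 by ring, Int.mul_ediv_cancel_left _ (by norm_num)]
    nlinarith

theorem two_mul_add_two_mul_ediv_two {a : ℤ} (ha : Even a) (b : ℤ) :
    2 * ((a + 2 * b) / 2) = a + 2 * b :=
  Int.two_mul_ediv_two_of_even (ha.add (even_two_mul b))

theorem free_point_contribution_ge (x : ℤ) :
    3 * (x * (x - 1)) + (x - 1) ≤
      4 * (((x - 1) * (x + 2) + 2 * sigma (x + 1)) / 2) := by
  have hx : Even ((x - 1) * (x + 2)) := by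
    simp only [Int.even_mul, Int.even_sub, Int.even_add]; grind
  have h := two_mul_add_two_mul_ediv_two hx (sigma (x + 1))
  have hs := sub_two_mul_sub_four_le_four_mul_sigma (x + 1)
  linarith

theorem satellite_point_contribution_ge (x : ℤ) :
    3 * (x * (x - 1)) - x ≤ 4 * ((x * (x - 1) + 2 * sigma (x + 2)) / 2) := by
  have h := two_mul_add_two_mul_ediv_two (Int.even_mul_pred_self x) (sigma (x + 2))
  have hs := sub_two_mul_sub_four_le_four_mul_sigma (x + 2)
  linarith

theorem origin_contribution_ge (n : ℤ) :
    3 * (n * (n - 1)) + (3 * n - 4) ≤ 4 * (sigma n + (n ^ 2 + 3 * n - 6) / 2) := by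
  have hn : Even (n ^ 2 + 3 * n - 6) := by
    rw [show n ^ 2 + 3 * n - 6 = n * (n + 1) + 2 * (n - 3) by ring]
    exact (Int.even_mul_succ_self n).add (even_two_mul _)
  have h := Int.two_mul_ediv_two_of_even hn
  have hs := sub_two_mul_sub_four_le_four_mul_sigma n
  linarith

/-- The combinatorial content of the answer to Dimca and Greuel's question for
plane branches: `4·τ_min - 3·μ ≥ 2n - 3 + Σ_F (e_p - 1) > 0`, so `3μ < 4·τ_min`. -/
theorem four_taumin_sub_three_mu_pos {F S : Type*} [Fintype F] [Fintype S]
    (n : ℤ) (hn : 2 ≤ n) (e : F ⊕ S → ℤ) (he : ∀ p, 1 ≤ e p)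
    (hsat : (∑ p : S, e (Sum.inr p)) = n - 1) :
    4 * (sigma n + (n ^ 2 + 3 * n - 6) / 2
        + (∑ p : F, ((e (Sum.inl p) - 1) * (e (Sum.inl p) + 2)
            + 2 * sigma (e (Sum.inl p) + 1)) / 2)
        + (∑ p : S, (e (Sum.inr p) * (e (Sum.inr p) - 1)
            + 2 * sigma (e (Sum.inr p) + 2)) / 2))
      - 3 * (n * (n - 1) + (∑ p : F, e (Sum.inl p) * (e (Sum.inl p) - 1))
        + (∑ p : S, e (Sum.inr p) * (e (Sum.inr p) - 1)))
      ≥ 2 * n - 3 + (∑ p : F, (e (Sum.inl p) - 1))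
    ∧ 2 * n - 3 + (∑ p : F, (e (Sum.inl p) - 1)) > 0
    ∧ 3 * (n * (n - 1) + (∑ p : F, e (Sum.inl p) * (e (Sum.inl p) - 1))
        + (∑ p : S, e (Sum.inr p) * (e (Sum.inr p) - 1)))
      < 4 * (sigma n + (n ^ 2 + 3 * n - 6) / 2
        + (∑ p : F, ((e (Sum.inl p) - 1) * (e (Sum.inl p) + 2)
            + 2 * sigma (e (Sum.inl p) + 1)) / 2)
        + (∑ p : S, (e (Sum.inr p) * (e (Sum.inr p) - 1)
            + 2 * sigma (e (Sum.inr p) + 2)) / 2)) := by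
  have hF := Finset.sum_le_sum fun p (_ : p ∈ (Finset.univ : Finset F)) ↦
    free_point_contribution_ge (e (Sum.inl p))
  have hS := Finset.sum_le_sum fun p (_ : p ∈ (Finset.univ : Finset S)) ↦
    satellite_point_contribution_ge (e (Sum.inr p))
  rw [Finset.sum_add_distrib, ← Finset.mul_sum, ← Finset.mul_sum] at hF
  rw [Finset.sum_sub_distrib, ← Finset.mul_sum, ← Finset.mul_sum, hsat] at hS
  have hO := origin_contribution_ge n
  have hpos : 0 ≤ ∑ p : F, (e (Sum.inl p) - 1) :=
    Finset.sum_nonneg fun p _ ↦ sub_nonneg.mpr (he (Sum.inl p))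
  refine ⟨?_, ?_, ?_⟩ <;> linarith
end

section
/- Let σ : ℤ → ℤ be defined by σ(k) = (k−2)(k−4)/4 if k is even and σ(k) = (k−3)²/4 if k is odd. Let n ≥ 2 be an integer, let F and S be finite index sets, and let e : F ⊕ S → ℤ satisfy e_p ≥ 1 for all p. Define τ_min = σ(n) + (n²+3n−6)/2 + Σ_{p∈F} ((e_p−1)(e_p+2) + 2σ(e_p+1))/2 + Σ_{p∈S} (e_p(e_p−1) + 2σ(e_p+2))/2. Then 4·τ_min ≥ 3n² − 4 if n is even, and 4·τ_min ≥ 3n² − 3 if n is odd; i.e., τ_min ≥ 3n²/4 − 1 for even n and τ_min ≥ 3(n²−1)/4 for odd n. -/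
theorem sigma_two_mul (m : ℤ) : sigma (2 * m) = (m - 1) * (m - 2) := by
  rw [sigma, if_pos (even_two_mul m),
    show (2 * m - 2) * (2 * m - 4) = (m - 1) * (m - 2) * 4 by ring,
    Int.mul_ediv_cancel _ (by norm_num)]

theorem sigma_two_mul_add_one (m : ℤ) : sigma (2 * m + 1) = (m - 1) ^ 2 := by
  rw [sigma, if_neg (Int.not_even_iff_odd.mpr (odd_two_mul_add_one m)),
    show (2 * m + 1 - 3) ^ 2 = (m - 1) ^ 2 * 4 by ring,
    Int.mul_ediv_cancel _ (by norm_num)]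

theorem sigma_nonneg (k : ℤ) : 0 ≤ sigma k := by
  obtain ⟨m, rfl | rfl⟩ := Int.even_or_odd' k
  · rw [sigma_two_mul]
    rcases le_or_gt m 1 with h | h
    · exact mul_nonneg_of_nonpos_of_nonpos (by linarith) (by linarith)
    · exact mul_nonneg (by linarith) (by linarith [Int.add_one_le_iff.mpr h])
  · rw [sigma_two_mul_add_one]
    positivity

theorem four_mul_sigma_add_of_even {n : ℤ} (h : Even n) :
    4 * (sigma n + (n ^ 2 + 3 * n - 6) / 2) = 3 * n ^ 2 - 4 := by
  obtain ⟨m, rfl⟩ := even_iff_two_dvd.mp h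
  rw [sigma_two_mul, show (2 * m) ^ 2 + 3 * (2 * m) - 6 = (2 * m ^ 2 + 3 * m - 3) * 2 by ring,
    Int.mul_ediv_cancel _ (by norm_num)]
  ring

theorem four_mul_sigma_add_of_odd {n : ℤ} (h : Odd n) :
    4 * (sigma n + (n ^ 2 + 3 * n - 6) / 2) = 3 * n ^ 2 - 3 := by
  obtain ⟨m, rfl⟩ := h
  rw [sigma_two_mul_add_one,
    show (2 * m + 1) ^ 2 + 3 * (2 * m + 1) - 6 = (2 * m ^ 2 + 5 * m - 1) * 2 by ring,
    Int.mul_ediv_cancel _ (by norm_num)]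
  ring

/-- Lower bounds for the minimal Tjurina number of an equisingularity class:
`τ_min ≥ 3n²/4 - 1` for even `n` and `τ_min ≥ 3(n² - 1)/4` for odd `n`. -/
theorem taumin_lower_bound {F S : Type*} [Fintype F] [Fintype S]
    (n : ℤ) (hn : 2 ≤ n) (e : F ⊕ S → ℤ) (he : ∀ p, 1 ≤ e p) :
    (Even n → 4 * (sigma n + (n ^ 2 + 3 * n - 6) / 2
        + (∑ p : F, ((e (Sum.inl p) - 1) * (e (Sum.inl p) + 2)
            + 2 * sigma (e (Sum.inl p) + 1)) / 2)
        + (∑ p : S, (e (Sum.inr p) * (e (Sum.inr p) - 1)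
            + 2 * sigma (e (Sum.inr p) + 2)) / 2)) ≥ 3 * n ^ 2 - 4)
    ∧ (Odd n → 4 * (sigma n + (n ^ 2 + 3 * n - 6) / 2
        + (∑ p : F, ((e (Sum.inl p) - 1) * (e (Sum.inl p) + 2)
            + 2 * sigma (e (Sum.inl p) + 1)) / 2)
        + (∑ p : S, (e (Sum.inr p) * (e (Sum.inr p) - 1)
            + 2 * sigma (e (Sum.inr p) + 2)) / 2)) ≥ 3 * n ^ 2 - 3) := by
  have hF : 0 ≤ ∑ p : F, ((e (Sum.inl p) - 1) * (e (Sum.inl p) + 2)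
      + 2 * sigma (e (Sum.inl p) + 1)) / 2 := by
    refine Finset.sum_nonneg fun p _ => Int.ediv_nonneg ?_ (by norm_num)
    have hp := he (Sum.inl p)
    have := sigma_nonneg (e (Sum.inl p) + 1)
    have := mul_nonneg (sub_nonneg.mpr hp) (by linarith : 0 ≤ e (Sum.inl p) + 2)
    linarith
  have hS : 0 ≤ ∑ p : S, (e (Sum.inr p) * (e (Sum.inr p) - 1)
      + 2 * sigma (e (Sum.inr p) + 2)) / 2 := by
    refine Finset.sum_nonneg fun p _ => Int.ediv_nonneg ?_ (by norm_num)
    have hp := he (Sum.inr p)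
    have := sigma_nonneg (e (Sum.inr p) + 2)
    have := mul_nonneg (by linarith : 0 ≤ e (Sum.inr p)) (sub_nonneg.mpr hp)
    linarith
  constructor <;> intro h
  · linarith [four_mul_sigma_add_of_even h]
  · linarith [four_mul_sigma_add_of_odd h]
end
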